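/- arXiv:math/0610699 — 2 statements merged into one kernel-verified Lean document; each statement's English description precedes it below -/
import Mathlib

section
/- Let d be a positive square-free integer with d ≡ 7 (mod 8), K = ℚ(√−d), R = 𝓞_K, and let K₈ denote the quaternion group of order 8. If u₁, …, uₙ are units of the group ring R K₈, then there exists a positive integer m such that the subgroup ⟨u₁ᵐ, …, uₙᵐ⟩ of the unit group of R K₈ is a free group of rank at most n, i.e., it is isomorphic to a free group on k generators for some k ≤ n. -/
open NumberField

theorem exists_padicInt_sq_eq_neg {d : ℤ} (hd7 : d % 8 = 7) :
    ∃ s : ℤ_[2], s ^ 2 = -(d : ℤ_[2]) := by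
  have key := hensels_lemma (p := 2) (R := ℤ) (F := Polynomial.X ^ 2 + Polynomial.C d) (a := 1) (by
    have h1 : ‖((1 + d : ℤ) : ℤ_[2])‖ ≤ (2 : ℕ) ^ (-(3 : ℕ) : ℤ) := by
      rw [PadicInt.norm_int_le_pow_iff_dvd]
      norm_num
      omega
    have h2 : ‖(2 : ℤ_[2])‖ = 2⁻¹ := by simpa using PadicInt.norm_p (p := 2)
    have h3 : (Polynomial.aeval (1 : ℤ_[2])) (Polynomial.X ^ 2 + Polynomial.C d : Polynomial ℤ)
        = ((1 + d : ℤ) : ℤ_[2]) := by simp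
    have h4 : (Polynomial.aeval (1 : ℤ_[2]))
        (Polynomial.derivative (Polynomial.X ^ 2 + Polynomial.C d : Polynomial ℤ)) = 2 := by
      simp [one_add_one_eq_two, map_ofNat]
    rw [h3, h4, h2]
    refine h1.trans_lt ?_
    norm_num)
  obtain ⟨s, hs, -⟩ := key
  refine ⟨s, ?_⟩
  simp at hs
  linear_combination hs

theorem ZMod.one_add_sq_add_sq_add_sq_ne_zero :
    ∀ x y z : ZMod (2 ^ 3), 1 + x ^ 2 + y ^ 2 + z ^ 2 ≠ 0 := by
  decide

theorem Padic.one_add_sq_add_sq_add_sq_ne_zero (x y z : ℚ_[2]) (hx : ‖x‖ ≤ 1) (hy : ‖y‖ ≤ 1)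
    (hz : ‖z‖ ≤ 1) : 1 + x ^ 2 + y ^ 2 + z ^ 2 ≠ 0 := by
  intro h
  obtain ⟨x, rfl⟩ : ∃ x' : ℤ_[2], (x' : ℚ_[2]) = x := ⟨⟨x, hx⟩, rfl⟩
  obtain ⟨y, rfl⟩ : ∃ y' : ℤ_[2], (y' : ℚ_[2]) = y := ⟨⟨y, hy⟩, rfl⟩
  obtain ⟨z, rfl⟩ : ∃ z' : ℤ_[2], (z' : ℚ_[2]) = z := ⟨⟨z, hz⟩, rfl⟩
  have h : 1 + x ^ 2 + y ^ 2 + z ^ 2 = 0 := Subtype.ext (by push_cast; exact h)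
  have := congrArg (PadicInt.toZModPow (p := 2) 3) h
  simp only [map_add, map_pow, map_one, map_zero] at this
  exact ZMod.one_add_sq_add_sq_add_sq_ne_zero _ _ _ this

theorem Padic.eq_zero_of_sum_four_sq_of_norm_le (w x y z : ℚ_[2]) (hx : ‖x‖ ≤ ‖w‖)
    (hy : ‖y‖ ≤ ‖w‖) (hz : ‖z‖ ≤ ‖w‖) (h : w ^ 2 + x ^ 2 + y ^ 2 + z ^ 2 = 0) : w = 0 := by
  by_contra hw
  have hw' : 0 < ‖w‖ := norm_pos_iff.2 hw
  refine Padic.one_add_sq_add_sq_add_sq_ne_zero (x / w) (y / w) (z / w) ?_ ?_ ?_ ?_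
  · rwa [norm_div, div_le_one hw']
  · rwa [norm_div, div_le_one hw']
  · rwa [norm_div, div_le_one hw']
  · field_simp
    simpa using h

theorem Padic.eq_zero_of_sum_four_sq (w x y z : ℚ_[2]) (h : w ^ 2 + x ^ 2 + y ^ 2 + z ^ 2 = 0) :
    w = 0 ∧ x = 0 ∧ y = 0 ∧ z = 0 := by
  obtain ⟨i, hi⟩ := Finite.exists_max fun i : Fin 4 => ‖(![w, x, y, z] : Fin 4 → ℚ_[2]) i‖
  have h0 := hi 0
  have h1 := hi 1
  have h2 := hi 2
  have h3 := hi 3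
  have key : (![w, x, y, z] : Fin 4 → ℚ_[2]) i = 0 := by
    fin_cases i <;> simp at h0 h1 h2 h3 ⊢
    · exact Padic.eq_zero_of_sum_four_sq_of_norm_le w x y z h1 h2 h3 h
    · exact Padic.eq_zero_of_sum_four_sq_of_norm_le x w y z h0 h2 h3 (by linear_combination h)
    · exact Padic.eq_zero_of_sum_four_sq_of_norm_le y w x z h0 h1 h3 (by linear_combination h)
    · exact Padic.eq_zero_of_sum_four_sq_of_norm_le z w x y h0 h1 h2 (by linear_combination h)
  simpa [key] using And.intro h0 (And.intro h1 (And.intro h2 h3))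

section ImaginaryQuadratic

variable {d : ℤ} {K : Type} [Field K] [NumberField K] {rd : 𝓞 K}

theorem nonempty_algHom_padic (hd7 : d % 8 = 7) (hrd : rd ^ 2 = -(d : 𝓞 K))
    (hgen : Algebra.adjoin ℚ {(rd : K)} = ⊤) : Nonempty (K →ₐ[ℚ] ℚ_[2]) := by
  obtain ⟨s, hs⟩ := exists_padicInt_sq_eq_neg hd7
  have hs' : (s : ℚ_[2]) ^ 2 = -(d : ℚ_[2]) := by
    exact_mod_cast congrArg (fun t : ℤ_[2] => (t : ℚ_[2])) hs
  have hrd' : (rd : K) ^ 2 = -(d : K) := by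
    have := congrArg (algebraMap (𝓞 K) K) hrd
    simpa using this
  refine IntermediateField.nonempty_algHom_of_adjoin_splits (S := {(rd : K)}) ?_ ?_
  · rintro x rfl
    refine ⟨Algebra.IsIntegral.isIntegral _, ?_⟩
    have hdvd : minpoly ℚ (rd : K) ∣ Polynomial.X ^ 2 + Polynomial.C (d : ℚ) := by
      apply minpoly.dvd
      simp [hrd']
    refine Polynomial.Splits.of_dvd (g := Polynomial.map (algebraMap ℚ ℚ_[2])
      (Polynomial.X ^ 2 + Polynomial.C (d : ℚ))) ?_ ?_ (Polynomial.map_dvd _ hdvd)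
    · have : Polynomial.map (algebraMap ℚ ℚ_[2]) (Polynomial.X ^ 2 + Polynomial.C (d : ℚ))
          = (Polynomial.X - Polynomial.C (s : ℚ_[2])) *
            (Polynomial.X + Polynomial.C (s : ℚ_[2])) := by
        have : Polynomial.C (d : ℚ_[2]) = - (Polynomial.C (s : ℚ_[2])) ^ 2 := by
          rw [← Polynomial.C_pow, hs']; simp
        simp only [Polynomial.map_add, Polynomial.map_pow, Polynomial.map_X, Polynomial.map_C]
        simp only [eq_ratCast, Rat.cast_intCast, this]
        ring
      rw [this]
      exact (Polynomial.Splits.X_sub_C _).mul (Polynomial.Splits.X_add_C _)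
    · rw [Ne, Polynomial.map_eq_zero]
      exact (Polynomial.monic_X_pow_add_C _ two_ne_zero).ne_zero
  · rw [eq_top_iff]
    intro x _
    have : x ∈ Algebra.adjoin ℚ {(rd : K)} := hgen ▸ Algebra.mem_top
    exact IntermediateField.algebra_adjoin_le_adjoin _ _ this

theorem eq_zero_of_sum_four_sq (hd7 : d % 8 = 7) (hrd : rd ^ 2 = -(d : 𝓞 K))
    (hgen : Algebra.adjoin ℚ {(rd : K)} = ⊤) (w x y z : 𝓞 K)
    (h : w ^ 2 + x ^ 2 + y ^ 2 + z ^ 2 = 0) : w = 0 ∧ x = 0 ∧ y = 0 ∧ z = 0 := by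
  obtain ⟨f⟩ := nonempty_algHom_padic hd7 hrd hgen
  let g : 𝓞 K →+* ℚ_[2] := f.toRingHom.comp (algebraMap (𝓞 K) K)
  have hg : Function.Injective g :=
    f.toRingHom.injective.comp (FaithfulSMul.algebraMap_injective (𝓞 K) K)
  have := congrArg g h
  simp only [map_add, map_pow, map_zero] at this
  simpa only [map_eq_zero_iff g hg] using Padic.eq_zero_of_sum_four_sq _ _ _ _ this

theorem norm_embedding_eq (hd : 0 < d) (hrd : rd ^ 2 = -(d : 𝓞 K))
    (hgen : Algebra.adjoin ℚ {(rd : K)} = ⊤) (φ σ : K →+* ℂ) (x : K) : ‖σ x‖ = ‖φ x‖ := by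
  have hrd' : (rd : K) ^ 2 = -(d : K) := by
    have := congrArg (algebraMap (𝓞 K) K) hrd
    simpa using this
  have hsq (τ : K →+* ℂ) : τ rd ^ 2 = -(d : ℂ) := by rw [← map_pow, hrd']; simp
  have hext (τ τ' : K →+* ℂ) (h : τ rd = τ' rd) : τ = τ' := by
    have : τ.toRatAlgHom = τ'.toRatAlgHom :=
      AlgHom.ext_of_adjoin_eq_top hgen (by rintro y rfl; exact h)
    ext y
    exact DFunLike.congr_fun this y
  have hconj : starRingEnd ℂ (φ rd) = - φ rd := by
    have h := hsq φ
    have hre := congrArg Complex.re h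
    have him := congrArg Complex.im h
    simp [pow_two] at hre him
    have hd' : (0 : ℝ) < d := by exact_mod_cast hd
    have h0 : (φ rd).re = 0 := by
      rcases mul_eq_zero.1 (show (φ rd).re * (φ rd).im = 0 by linarith) with h | h
      · exact h
      · rw [h] at hre; nlinarith
    apply Complex.ext <;> simp [h0]
  rcases sq_eq_sq_iff_eq_or_eq_neg.1 ((hsq σ).trans (hsq φ).symm) with h | h
  · rw [hext σ φ h]
  · rw [hext σ ((starRingEnd ℂ).comp φ) (by simp [h, hconj])]
    simp

theorem norm_embedding_eq_one (hd : 0 < d) (hrd : rd ^ 2 = -(d : 𝓞 K))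
    (hgen : Algebra.adjoin ℚ {(rd : K)} = ⊤) (φ : K →+* ℂ) (x : 𝓞 K) (hx : x ≠ 0)
    (h : ‖φ x‖ ≤ 1) : ‖φ x‖ = 1 := by
  have hprod := Algebra.norm_eq_prod_embeddings ℚ ℂ (x : K)
  have hn : ‖(algebraMap ℚ ℂ) (Algebra.norm ℚ (x : K))‖ = ‖φ x‖ ^ Fintype.card (K →ₐ[ℚ] ℂ) := by
    rw [hprod, norm_prod,
      Finset.prod_congr rfl (fun σ _ => norm_embedding_eq hd hrd hgen φ σ.toRingHom x)]
    simp
  rw [← Algebra.coe_norm_int] at hn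
  have h1 : 1 ≤ ‖φ x‖ ^ Fintype.card (K →ₐ[ℚ] ℂ) := by
    rw [← hn]
    have : Algebra.norm ℤ x ≠ 0 := Algebra.norm_ne_zero_iff.2 hx
    have h2 : 1 ≤ |Algebra.norm ℤ x| := Int.one_le_abs this
    simp only [eq_ratCast, Rat.cast_intCast]
    rw [Complex.norm_intCast]
    exact_mod_cast h2
  by_contra hne
  have : Nonempty (K →ₐ[ℚ] ℂ) := ⟨φ.toRatAlgHom⟩
  have := pow_lt_one₀ (norm_nonneg _) (lt_of_le_of_ne h hne) (n := Fintype.card (K →ₐ[ℚ] ℂ))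
    Fintype.card_ne_zero
  linarith

theorem exists_pow_eq_one_of_isUnit (hd : 0 < d) (hrd : rd ^ 2 = -(d : 𝓞 K))
    (hgen : Algebra.adjoin ℚ {(rd : K)} = ⊤) (x : (𝓞 K)ˣ) :
    ∃ n, 0 < n ∧ x ^ n = 1 := by
  have φ : K →+* ℂ := Classical.arbitrary _
  have hle : ∀ y : (𝓞 K)ˣ, ‖φ (y : 𝓞 K)‖ ≤ 1 → ‖φ (y : 𝓞 K)‖ = 1 := fun y hy =>
    norm_embedding_eq_one hd hrd hgen φ y y.ne_zero hy
  have h1 : ‖φ (x : 𝓞 K)‖ = 1 := by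
    rcases le_total ‖φ (x : 𝓞 K)‖ 1 with h | h
    · exact hle x h
    · have hm : ‖φ (x : 𝓞 K)‖ * ‖φ ((x⁻¹ : (𝓞 K)ˣ) : 𝓞 K)‖ = 1 := by
        rw [← norm_mul, ← map_mul, ← map_mul]; simp
      have h2 := hle x⁻¹ (by nlinarith [norm_nonneg (φ ((x⁻¹ : (𝓞 K)ˣ) : 𝓞 K))])
      rwa [h2, mul_one] at hm
  obtain ⟨n, hn, hx⟩ := Embeddings.pow_eq_one_of_norm_eq_one K ℂ (x : 𝓞 K).isIntegral_coe
    (fun σ => (norm_embedding_eq hd hrd hgen φ σ _).trans h1)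
  refine ⟨n, hn, ?_⟩
  ext
  simpa using hx

theorem finite_norm_embedding_le (hd : 0 < d) (hrd : rd ^ 2 = -(d : 𝓞 K))
    (hgen : Algebra.adjoin ℚ {(rd : K)} = ⊤) (φ : K →+* ℂ) (B : ℝ) :
    {x : 𝓞 K | ‖φ x‖ ≤ B}.Finite := by
  refine Set.Finite.of_finite_image ?_ (FaithfulSMul.algebraMap_injective (𝓞 K) K).injOn
  refine (Embeddings.finite_of_norm_le K ℂ B).subset ?_
  rintro _ ⟨x, hx, rfl⟩
  exact ⟨x.isIntegral_coe, fun σ => (norm_embedding_eq hd hrd hgen φ σ _).trans_le hx⟩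

theorem eq_of_embedding_eq_ofReal (hd : 0 < d) (hrd : rd ^ 2 = -(d : 𝓞 K))
    (hgen : Algebra.adjoin ℚ {(rd : K)} = ⊤) (φ : K →+* ℂ) (x : 𝓞 K) (r : ℝ) (hr : |r| ≤ 1)
    (h : φ x = r) : x = 0 ∨ x = 1 ∨ x = -1 := by
  have hinj : Function.Injective (φ.comp (algebraMap (𝓞 K) K)) := 
    φ.injective.comp (FaithfulSMul.algebraMap_injective (𝓞 K) K)
  by_cases hx : x = 0
  · exact .inl hx
  right
  have h1 := norm_embedding_eq_one hd hrd hgen φ x hx (by simpa [h] using hr)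
  rw [h, Complex.norm_real, Real.norm_eq_abs] at h1
  rcases eq_or_eq_neg_of_abs_eq h1 with rfl | rfl
  · left; apply hinj; simpa using h
  · right; apply hinj; simpa using h

end ImaginaryQuadratic

section

open Filter Matrix

section PingPong

theorem FreeGroup.injective_lift_of_subsingleton {ι G : Type*} [Group G] [Subsingleton ι]
    (a : ι → G) (ha : ∀ i, ∀ k : ℤ, a i ^ k = 1 → k = 0) :
    Function.Injective (FreeGroup.lift a) := by
  rw [injective_iff_map_eq_one]
  intro w hw
  have hmem : w ∈ Subgroup.closure (Set.range (FreeGroup.of : ι → FreeGroup ι)) := by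
    rw [FreeGroup.closure_range_of]; trivial
  rcases isEmpty_or_nonempty ι with h | ⟨⟨i⟩⟩
  · exact Subsingleton.elim _ _
  · have : Set.range (FreeGroup.of : ι → FreeGroup ι) = {FreeGroup.of i} := by
      ext x
      simp only [Set.mem_range, Set.mem_singleton_iff]
      exact ⟨fun ⟨j, hj⟩ => by rw [← hj, Subsingleton.elim j i], fun h => ⟨i, h.symm⟩⟩
    rw [this, Subgroup.mem_closure_singleton] at hmem
    obtain ⟨k, rfl⟩ := hmem
    rw [map_zpow, FreeGroup.lift_apply_of] at hw
    rw [ha i k hw, zpow_zero]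

theorem FreeGroup.injective_lift_of_expanding {ι G : Type} {α : Type*} [Group G] [MulAction G α]
    [Nontrivial ι] (a : ι → G) (p q : ι → α → ℝ) (C : ℝ) (hC : 1 ≤ C) (L : ι → ℝ)
    (hL : ∀ i, C < L i) (hp : ∀ i w, 0 ≤ p i w) (hq : ∀ i w, 0 ≤ q i w)
    (hpq : ∀ i w, p i w = 0 → q i w ≠ 0) (hne : ∀ i, ∃ w, q i w = 0)
    (hdisj : ∀ i j, i ≠ j → ∀ w, (C * q i w < p i w ∨ C * p i w < q i w) →
      ¬ (C * q j w < p j w ∨ C * p j w < q j w))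
    (hap : ∀ i w, p i (a i • w) = L i * p i w) (haq : ∀ i w, L i * q i (a i • w) = q i w) :
    Function.Injective (FreeGroup.lift a) := by
  have hL0 : ∀ i, 0 < L i := fun i => by linarith [hL i]
  have key : ∀ i (s t s' t' : ℝ), 0 ≤ s → 0 ≤ t → (s = 0 → t ≠ 0) → t ≤ C * s → s' = L i * s →
      L i * t' = t → C * t' < s' := by
    intro i s t s' t' hs ht hst h hs' ht'
    have hs0 : 0 < s := by
      rcases hs.eq_or_lt with h0 | h0
      · exact absurd (le_antisymm (by rw [← h0, mul_zero] at h; exact h) ht) (hst h0.symm)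
      · exact h0
    have h1 : L i * (C * t') ≤ C * (C * s) := by
      calc L i * (C * t') = C * (L i * t') := by ring
        _ ≤ C * (C * s) := by rw [ht']; gcongr
    have h2 : C * (C * s) < L i * (L i * s) := by
      have := hL i
      gcongr
    rw [hs']
    exact lt_of_mul_lt_mul_left (h1.trans_lt h2) (hL0 i).le
  refine FreeGroup.injective_lift_of_ping_pong a (fun i => {w | C * q i w < p i w})
    (fun i => {w | C * p i w < q i w}) ?_ ?_ ?_ ?_ ?_ ?_
  · intro i
    obtain ⟨w, hw⟩ := hne i
    refine ⟨w, ?_⟩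
    simp only [Set.mem_ofPred_eq, hw, mul_zero]
    exact lt_of_le_of_ne (hp i w) fun h => hpq i w h.symm hw
  · exact fun i j hij => Set.disjoint_left.2 fun w h h' => hdisj i j hij w (.inl h) (.inl h')
  · exact fun i j hij => Set.disjoint_left.2 fun w h h' => hdisj i j hij w (.inr h) (.inr h')
  · intro i j
    refine Set.disjoint_left.2 fun w h h' => ?_
    by_cases hij : i = j
    · subst hij
      simp only [Set.mem_ofPred_eq] at h h'
      nlinarith [hp i w, hq i w]
    · exact hdisj i j hij w (.inl h) (.inr h')
  · rintro i _ ⟨w, hw, rfl⟩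
    simp only [Set.mem_compl_iff, Set.mem_ofPred_eq, not_lt] at hw
    exact key i _ _ _ _ (hp i w) (hq i w) (hpq i w) hw (hap i w) (haq i w)
  · rintro i _ ⟨w, hw, rfl⟩
    simp only [Set.mem_compl_iff, Set.mem_ofPred_eq, not_lt] at hw
    have h1 := hap i (a⁻¹ i • w)
    have h2 := haq i (a⁻¹ i • w)
    simp only [Pi.inv_apply, smul_inv_smul] at h1 h2
    exact key i _ _ _ _ (hq i w) (hp i w) (fun h h' => hpq i w h' h) hw h2.symm h1.symm

end PingPong

section Eigencovectors

/-- `ℓ` is a nonzero row vector with `ℓ A = ν ℓ`. -/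
def IsEigencovector (A : Matrix (Fin 2) (Fin 2) ℂ) (ν : ℂ) (l : Fin 2 → ℂ) : Prop :=
  l ≠ 0 ∧ l ᵥ* A = ν • l

theorem exists_isEigencovector {A : Matrix (Fin 2) (Fin 2) ℂ} {ν : ℂ} (hA : A.det = 1)
    (h : ν ^ 2 - A.trace * ν + 1 = 0) : ∃ l, IsEigencovector A ν l := by
  have : (A - ν • (1 : Matrix (Fin 2) (Fin 2) ℂ)).det = 0 := by
    rw [det_fin_two] at hA ⊢
    rw [trace_fin_two] at h
    simp
    linear_combination h + hA
  obtain ⟨l, hl, h⟩ := exists_vecMul_eq_zero_iff.2 this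
  refine ⟨l, hl, ?_⟩
  rwa [vecMul_sub, vecMul_smul, vecMul_one, sub_eq_zero] at h

namespace IsEigencovector

variable {A B : Matrix (Fin 2) (Fin 2) ℂ} {μ ν : ℂ} {l m : Fin 2 → ℂ}

theorem charpoly_eq_zero (hA : A.det = 1) (h : IsEigencovector A ν l) :
    ν ^ 2 - A.trace * ν + 1 = 0 := by
  have : (A - ν • (1 : Matrix (Fin 2) (Fin 2) ℂ)).det = 0 := by
    refine exists_vecMul_eq_zero_iff.1 ⟨l, h.1, ?_⟩
    rw [vecMul_sub, vecMul_smul, vecMul_one, h.2, sub_self]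
  rw [det_fin_two] at hA this
  rw [trace_fin_two]
  simp at this
  linear_combination this - hA

theorem ne_zero (hA : A.det = 1) (h : IsEigencovector A ν l) : ν ≠ 0 := by
  rintro rfl
  simpa using h.charpoly_eq_zero hA

theorem trace_eq (hA : A.det = 1) (h : IsEigencovector A ν l) : A.trace = ν + ν⁻¹ := by
  have := h.charpoly_eq_zero hA
  have := h.ne_zero hA
  field_simp
  linear_combination -h.charpoly_eq_zero hA

theorem one (hl : l ≠ 0) : IsEigencovector 1 1 l := ⟨hl, by simp⟩

theorem mul (hA : IsEigencovector A μ l) (hB : IsEigencovector B ν l) :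
    IsEigencovector (A * B) (μ * ν) l :=
  ⟨hA.1, by rw [← vecMul_vecMul, hA.2, smul_vecMul, hB.2, smul_smul]⟩

theorem unique (h : IsEigencovector A μ l) (h' : IsEigencovector A ν l) : μ = ν :=
  smul_left_injective ℂ h.1 (h.2.symm.trans h'.2)

theorem dotProduct_mulVec (h : IsEigencovector A ν l) (w : Fin 2 → ℂ) :
    l ⬝ᵥ (A *ᵥ w) = ν * (l ⬝ᵥ w) := by
  rw [Matrix.dotProduct_mulVec, h.2, smul_dotProduct, smul_eq_mul]

/-- Parallel nonzero row vectors have the same eigenvalue. -/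
theorem of_parallel (h : IsEigencovector A ν l) (hm : m ≠ 0) (hlm : l 0 * m 1 = l 1 * m 0) :
    IsEigencovector A ν m := by
  obtain ⟨c, hc⟩ : ∃ c : ℂ, m = c • l := by
    by_cases h0 : l 0 = 0
    · have h1 : l 1 ≠ 0 := fun h1 => h.1 (by ext i; fin_cases i <;> simp [h0, h1])
      refine ⟨m 1 / l 1, ?_⟩
      ext i
      fin_cases i
      · have : m 0 = 0 := by simpa [h0, h1] using hlm.symm
        simp [h0, this]
      · simp; field_simp
    · refine ⟨m 0 / l 0, ?_⟩
      ext i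
      fin_cases i
      · simp; field_simp
      · simp; field_simp; linear_combination hlm
  refine ⟨hm, ?_⟩
  rw [hc, smul_vecMul, h.2, smul_comm]

end IsEigencovector

theorem eventually_not_and_lt {l m : Fin 2 → ℂ} (h : l 0 * m 1 ≠ l 1 * m 0) (l' m' : Fin 2 → ℂ) :
    ∀ᶠ C : ℝ in atTop, ∀ w : Fin 2 → ℂ,
      ¬ (C * ‖l ⬝ᵥ w‖ < ‖l' ⬝ᵥ w‖ ∧ C * ‖m ⬝ᵥ w‖ < ‖m' ⬝ᵥ w‖) := by
  have hδ : l 0 * m 1 - l 1 * m 0 ≠ 0 := sub_ne_zero.2 h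
  have key : ∀ k : Fin 2 → ℂ, ∃ B : ℝ, ∀ w : Fin 2 → ℂ,
      ‖k ⬝ᵥ w‖ ≤ B * (‖l ⬝ᵥ w‖ + ‖m ⬝ᵥ w‖) := by
    intro k
    obtain ⟨a, ha⟩ : ∃ a, a * (l 0 * m 1 - l 1 * m 0) = k 0 * m 1 - k 1 * m 0 :=
      ⟨_, div_mul_cancel₀ _ hδ⟩
    obtain ⟨b, hb⟩ : ∃ b, b * (l 0 * m 1 - l 1 * m 0) = l 0 * k 1 - l 1 * k 0 :=
      ⟨_, div_mul_cancel₀ _ hδ⟩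
    refine ⟨max ‖a‖ ‖b‖, fun w => ?_⟩
    have : k ⬝ᵥ w = a * (l ⬝ᵥ w) + b * (m ⬝ᵥ w) := by
      simp only [dotProduct, Fin.sum_univ_two]
      apply mul_right_cancel₀ hδ
      linear_combination -(l 0 * w 0 + l 1 * w 1) * ha - (m 0 * w 0 + m 1 * w 1) * hb
    rw [this, mul_add]
    refine (norm_add_le _ _).trans ?_
    rw [norm_mul, norm_mul]
    gcongr
    · exact le_max_left _ _
    · exact le_max_right _ _
  obtain ⟨B, hB⟩ := key l'
  obtain ⟨B', hB'⟩ := key m'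
  filter_upwards [eventually_ge_atTop (B + B')] with C hC w ⟨h1, h2⟩
  nlinarith [hB w, hB' w, norm_nonneg (l ⬝ᵥ w), norm_nonneg (m ⬝ᵥ w)]

end Eigencovectors

theorem exists_sq_sub_mul_add_one_eq_zero (t : ℂ) : ∃ ν : ℂ, ν ^ 2 - t * ν + 1 = 0 := by
  obtain ⟨ν, hν⟩ := IsAlgClosed.exists_root
    (Polynomial.C 1 * Polynomial.X ^ 2 + Polynomial.C (-t) * Polynomial.X + Polynomial.C 1)
    (by rw [Polynomial.degree_quadratic one_ne_zero]; norm_num)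
  refine ⟨ν, ?_⟩
  simp [Polynomial.IsRoot] at hν
  linear_combination hν

section Representation

variable {G : Type} [Group G] {ρ : G →* Matrix (Fin 2) (Fin 2) ℂ}

/-- The action on nonzero column vectors through a matrix representation. -/
@[reducible]
def nonzeroVectorAction (ρ : G →* Matrix (Fin 2) (Fin 2) ℂ) :
    MulAction G {w : Fin 2 → ℂ // w ≠ 0} where
  smul g w := ⟨ρ g *ᵥ w.1, fun h => w.2 (by
    have := congrArg (ρ g⁻¹ *ᵥ ·) h
    simp only [mulVec_mulVec, ← map_mul, inv_mul_cancel, map_one, one_mulVec, mulVec_zero] at this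
    exact this)⟩
  one_smul w := Subtype.ext (by change ρ 1 *ᵥ w.1 = w.1; simp)
  mul_smul g h w := Subtype.ext (by
    change ρ (g * h) *ᵥ w.1 = ρ g *ᵥ (ρ h *ᵥ w.1)
    rw [map_mul, mulVec_mulVec])

theorem IsEigencovector.map_inv {g : G} {ν : ℂ} {l : Fin 2 → ℂ} (hν : ν ≠ 0)
    (h : IsEigencovector (ρ g) ν l) : IsEigencovector (ρ g⁻¹) ν⁻¹ l := by
  refine ⟨h.1, ?_⟩
  have h1 : (l ᵥ* ρ g) ᵥ* ρ g⁻¹ = l := by rw [vecMul_vecMul, ← map_mul]; simp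
  rw [h.2, smul_vecMul] at h1
  rw [← h1, smul_smul, inv_mul_cancel₀ hν, one_smul, h1]

theorem IsEigencovector.map_pow {g : G} {ν : ℂ} {l : Fin 2 → ℂ}
    (h : IsEigencovector (ρ g) ν l) (k : ℕ) : IsEigencovector (ρ (g ^ k)) (ν ^ k) l := by
  induction k with
  | zero => simpa using IsEigencovector.one h.1
  | succ k ih => rw [pow_succ, pow_succ, map_mul]; exact ih.mul h

theorem IsEigencovector.map_zpow {g : G} {ν : ℂ} {l : Fin 2 → ℂ} (hν : ν ≠ 0)
    (h : IsEigencovector (ρ g) ν l) (k : ℤ) : IsEigencovector (ρ (g ^ k)) (ν ^ k) l := by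
  obtain ⟨k, rfl | rfl⟩ := k.eq_nat_or_neg
  · simpa using h.map_pow k
  · simpa using (h.map_pow k).map_inv (pow_ne_zero k hν)

theorem zpow_eq_zero_of_zpow_eq_one (hdet : ∀ g, (ρ g).det = 1)
    (hunit : ∀ g ν l, IsEigencovector (ρ g) ν l → ‖ν‖ = 1 → g ^ 4 = 1)
    {g : G} (hg : g ^ 4 ≠ 1) {k : ℤ} (hk : g ^ k = 1) : k = 0 := by
  by_contra hk0
  obtain ⟨ν, hν⟩ := exists_sq_sub_mul_add_one_eq_zero (ρ g).trace
  obtain ⟨l, hl⟩ := exists_isEigencovector (hdet g) hν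
  have h1 := hl.map_zpow (hl.ne_zero (hdet g)) k
  rw [hk, map_one] at h1
  have h2 := congrArg norm (h1.unique (IsEigencovector.one hl.1))
  rw [norm_zpow, norm_one] at h2
  by_cases h1' : ‖ν‖ = 1
  · exact hg (hunit g ν l hl h1')
  · exact hk0 ((zpow_eq_one_iff_right₀ (norm_nonneg _) h1').1 h2)

theorem exists_expanding_eigencovectors (hdet : ∀ g, (ρ g).det = 1)
    (hunit : ∀ g ν l, IsEigencovector (ρ g) ν l → ‖ν‖ = 1 → g ^ 4 = 1)
    {g : G} (hg : g ^ 4 ≠ 1) : ∃ ν l m, 1 < ‖ν‖ ∧ IsEigencovector (ρ g) ν l ∧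
      IsEigencovector (ρ g) ν⁻¹ m := by
  obtain ⟨ν, hν⟩ := exists_sq_sub_mul_add_one_eq_zero (ρ g).trace
  obtain ⟨l, hl⟩ := exists_isEigencovector (hdet g) hν
  have hν0 := hl.ne_zero (hdet g)
  obtain ⟨m, hm⟩ := exists_isEigencovector (ν := ν⁻¹) (hdet g) (by
    field_simp
    linear_combination hν)
  rcases lt_trichotomy ‖ν‖ 1 with h | h | h
  · refine ⟨ν⁻¹, m, l, ?_, hm, by rwa [inv_inv]⟩
    rw [norm_inv]
    exact (one_lt_inv₀ (norm_pos_iff.2 hν0)).2 h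
  · exact absurd (hunit g ν l hl h) hg
  · exact ⟨ν, l, m, h, hl, hm⟩

theorem exists_zpow_eq_zpow (hdet : ∀ g, (ρ g).det = 1)
    (hunit : ∀ g ν l, IsEigencovector (ρ g) ν l → ‖ν‖ = 1 → g ^ 4 = 1)
    (hcomm : ∀ g h μ ν l, IsEigencovector (ρ g) μ l → IsEigencovector (ρ h) ν l → Commute g h)
    (hfin : ∀ B : ℝ, {t : ℂ | (∃ g, (ρ g).trace = t) ∧ ‖t‖ ≤ B}.Finite)
    {g h : G} (hg : g ^ 4 ≠ 1) (hh : h ^ 4 ≠ 1) {μ ν : ℂ} {l : Fin 2 → ℂ}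
    (hgl : IsEigencovector (ρ g) μ l) (hhl : IsEigencovector (ρ h) ν l) :
    ∃ a b : ℤ, a ≠ 0 ∧ b ≠ 0 ∧ g ^ a = h ^ b := by
  have hμ := hgl.ne_zero (hdet g)
  have hν := hhl.ne_zero (hdet h)
  have hc : Commute g h := hcomm g h μ ν l hgl hhl
  set L := Real.log ‖μ‖ with hL
  set M := Real.log ‖ν‖ with hM
  have hM0 : M ≠ 0 := by
    intro h0
    rw [hM, Real.log_eq_zero] at h0
    rcases h0 with h0 | h0 | h0
    · exact hν (norm_eq_zero.1 h0)
    · exact hh (hunit h ν l hhl h0)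
    · linarith [norm_nonneg ν]
  let f : ℕ → ℤ := fun a => -⌊(a : ℝ) * L / M⌋
  have heig : ∀ a : ℕ, IsEigencovector (ρ (g ^ (a : ℤ) * h ^ f a)) (μ ^ (a : ℤ) * ν ^ f a) l := by
    intro a
    rw [map_mul]
    exact (hgl.map_zpow hμ a).mul (hhl.map_zpow hν _)
  have hlog : ∀ a : ℕ, |Real.log ‖μ ^ (a : ℤ) * ν ^ f a‖| ≤ |M| := by
    intro a
    have : Real.log ‖μ ^ (a : ℤ) * ν ^ f a‖ = M * Int.fract ((a : ℝ) * L / M) := by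
      rw [norm_mul, norm_zpow, norm_zpow, Real.log_mul (zpow_ne_zero _ (norm_ne_zero_iff.2 hμ))
        (zpow_ne_zero _ (norm_ne_zero_iff.2 hν)), Real.log_zpow, Real.log_zpow, Int.fract]
      simp only [f]
      push_cast
      field_simp
      ring
    rw [this, abs_mul, abs_of_nonneg (a := Int.fract _) (Int.fract_nonneg _)]
    exact mul_le_of_le_one_right (abs_nonneg _) (Int.fract_lt_one _).le
  set B := 2 * Real.exp |M|
  have hS : {x : ℂ | ∃ t ∈ {t : ℂ | (∃ g, (ρ g).trace = t) ∧ ‖t‖ ≤ B},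
      x ^ 2 - t * x + 1 = 0}.Finite := by
    have : {x : ℂ | ∃ t ∈ {t : ℂ | (∃ g, (ρ g).trace = t) ∧ ‖t‖ ≤ B}, x ^ 2 - t * x + 1 = 0} =
        ⋃ t ∈ {t : ℂ | (∃ g, (ρ g).trace = t) ∧ ‖t‖ ≤ B}, {x : ℂ | x ^ 2 - t * x + 1 = 0} := by
      ext x; simp
    rw [this]
    refine (hfin B).biUnion fun t _ => ?_
    have hP : (Polynomial.C 1 * Polynomial.X ^ 2 + Polynomial.C (-t) * Polynomial.X
        + Polynomial.C 1 : Polynomial ℂ) ≠ 0 := by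
      intro h0
      have := Polynomial.degree_quadratic (b := -t) (c := 1) (one_ne_zero (α := ℂ))
      rw [h0] at this
      simp at this
    refine (Polynomial.finite_setOfPred_isRoot hP).subset fun x hx => ?_
    simp only [Set.mem_ofPred_eq] at hx
    simp [Polynomial.IsRoot]
    linear_combination hx
  obtain ⟨a, -, a', -, haa, heq⟩ := Set.infinite_univ.exists_ne_map_eq_of_mapsTo
    (f := fun a : ℕ => μ ^ (a : ℤ) * ν ^ f a) (fun a _ => by
      refine ⟨_, ⟨⟨_, rfl⟩, ?_⟩, (heig a).charpoly_eq_zero (hdet _)⟩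
      rw [(heig a).trace_eq (hdet _)]
      have hpos : 0 < ‖μ ^ (a : ℤ) * ν ^ f a‖ := norm_pos_iff.2 ((heig a).ne_zero (hdet _))
      have h1 := abs_le.1 (hlog a)
      refine (norm_add_le _ _).trans ?_
      rw [norm_inv]
      have h2 : ‖μ ^ (a : ℤ) * ν ^ f a‖ ≤ Real.exp |M| := by
        rw [← Real.log_le_iff_le_exp hpos]; exact h1.2
      have h3 : ‖μ ^ (a : ℤ) * ν ^ f a‖⁻¹ ≤ Real.exp |M| := by
        rw [← Real.log_le_iff_le_exp (inv_pos.2 hpos), Real.log_inv]; linarith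
      simp only [B]
      linarith) hS
  have hw : (g ^ ((a : ℤ) - a') * h ^ (f a - f a')) ^ 4 = 1 := by
    refine hunit _ 1 l ?_ norm_one
    rw [map_mul]
    convert (hgl.map_zpow hμ ((a : ℤ) - a')).mul (hhl.map_zpow hν (f a - f a')) using 1
    have h0 := (heig a').ne_zero (hdet _)
    have h1 : μ ^ (a' : ℤ) ≠ 0 := zpow_ne_zero _ hμ
    have h2 : ν ^ f a' ≠ 0 := zpow_ne_zero _ hν
    rw [zpow_sub₀ hμ, zpow_sub₀ hν, div_mul_div_comm, heq, div_self h0]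
  rw [((hc.zpow_zpow _ _).mul_pow 4), ← _root_.zpow_natCast, ← _root_.zpow_natCast,
    ← _root_.zpow_mul, ← _root_.zpow_mul, mul_eq_one_iff_eq_inv, ← _root_.zpow_neg] at hw
  have ha : ((a : ℤ) - a') * (4 : ℕ) ≠ 0 := by
    push_cast
    omega
  refine ⟨_, _, ha, ?_, hw⟩
  intro hb
  rw [hb, zpow_zero] at hw
  exact ha (zpow_eq_zero_of_zpow_eq_one hdet hunit hg hw)

theorem eventually_injective_lift_pow (hdet : ∀ g, (ρ g).det = 1)
    (hunit : ∀ g ν l, IsEigencovector (ρ g) ν l → ‖ν‖ = 1 → g ^ 4 = 1)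
    {ι : Type} [Finite ι] (z : ι → G) (hz : ∀ i, z i ^ 4 ≠ 1)
    (hindep : ∀ i j, i ≠ j → ∀ μ ν l, IsEigencovector (ρ (z i)) μ l →
      ¬ IsEigencovector (ρ (z j)) ν l) :
    ∀ᶠ M : ℕ in atTop, Function.Injective (FreeGroup.lift fun i => z i ^ M) := by
  rcases subsingleton_or_nontrivial ι with hι | hι
  · filter_upwards [eventually_gt_atTop 0] with M hM
    refine FreeGroup.injective_lift_of_subsingleton _ fun i k hk => ?_
    rw [← _root_.zpow_natCast, ← _root_.zpow_mul] at hk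
    have := zpow_eq_zero_of_zpow_eq_one hdet hunit (hz i) hk
    rcases mul_eq_zero.1 this with h | h
    · omega
    · exact h
  choose ν l m hν hl hm using fun i => exists_expanding_eigencovectors hdet hunit (hz i)
  have hν0 : ∀ i, ν i ≠ 0 := fun i => (hl i).ne_zero (hdet _)
  have hpar : ∀ i j, i ≠ j → ∀ {μ μ' l l'}, IsEigencovector (ρ (z i)) μ l →
      IsEigencovector (ρ (z j)) μ' l' → l 0 * l' 1 ≠ l 1 * l' 0 :=
    fun i j hij μ μ' l l' h h' hp => hindep i j hij μ μ' l' (h.of_parallel h'.1 hp) h'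
  have hlm : ∀ i, l i 0 * m i 1 ≠ l i 1 * m i 0 := fun i hp => by
    have h1 := congrArg norm (((hl i).of_parallel (hm i).1 hp).unique (hm i))
    rw [norm_inv] at h1
    have := inv_lt_one_of_one_lt₀ (hν i)
    linarith [hν i]
  obtain ⟨C, hC⟩ : ∃ C : ℝ, 1 ≤ C ∧ ∀ i j, i ≠ j → ∀ w : Fin 2 → ℂ,
      (C * ‖m i ⬝ᵥ w‖ < ‖l i ⬝ᵥ w‖ ∨ C * ‖l i ⬝ᵥ w‖ < ‖m i ⬝ᵥ w‖) →
      ¬ (C * ‖m j ⬝ᵥ w‖ < ‖l j ⬝ᵥ w‖ ∨ C * ‖l j ⬝ᵥ w‖ < ‖m j ⬝ᵥ w‖) := by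
    have : ∀ᶠ C : ℝ in atTop, 1 ≤ C ∧ ∀ i j, i ≠ j → ∀ w : Fin 2 → ℂ,
      (C * ‖m i ⬝ᵥ w‖ < ‖l i ⬝ᵥ w‖ ∨ C * ‖l i ⬝ᵥ w‖ < ‖m i ⬝ᵥ w‖) →
      ¬ (C * ‖m j ⬝ᵥ w‖ < ‖l j ⬝ᵥ w‖ ∨ C * ‖l j ⬝ᵥ w‖ < ‖m j ⬝ᵥ w‖) := by
      refine (eventually_ge_atTop 1).and ?_
      refine eventually_all.2 fun i => eventually_all.2 fun j => ?_
      by_cases hij : i = j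
      · simp [hij]
      filter_upwards [eventually_not_and_lt (hpar i j hij (hl i) (hl j)) (m i) (m j),
        eventually_not_and_lt (hpar i j hij (hl i) (hm j)) (m i) (l j),
        eventually_not_and_lt (hpar i j hij (hm i) (hl j)) (l i) (m j),
        eventually_not_and_lt (hpar i j hij (hm i) (hm j)) (l i) (l j)] with C h1 h2 h3 h4 _ w
      have := h1 w
      have := h2 w
      have := h3 w
      have := h4 w
      tauto
    exact this.exists
  have hlarge : ∀ᶠ M : ℕ in atTop, ∀ i, C < ‖ν i‖ ^ M :=
    eventually_all.2 fun i =>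
      (tendsto_pow_atTop_atTop_of_one_lt (hν i)).eventually_gt_atTop C
  filter_upwards [hlarge] with M hM
  let _ := nonzeroVectorAction ρ
  refine FreeGroup.injective_lift_of_expanding (α := {w : Fin 2 → ℂ // w ≠ 0}) _
    (fun i w => ‖l i ⬝ᵥ w.1‖) (fun i w => ‖m i ⬝ᵥ w.1‖) C hC.1
    (fun i => ‖ν i‖ ^ M) hM (fun _ _ => norm_nonneg _) (fun _ _ => norm_nonneg _) ?_ ?_
    (fun i j hij w => hC.2 i j hij w.1) ?_ ?_
  · intro i w h1 h2
    rw [norm_eq_zero] at h1 h2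
    apply w.2
    have hδ := sub_ne_zero.2 (hlm i)
    simp only [dotProduct, Fin.sum_univ_two] at h1 h2
    ext k
    fin_cases k
    · apply mul_left_cancel₀ hδ
      simp only [Fin.zero_eta, Pi.zero_apply]
      linear_combination m i 1 * h1 - l i 1 * h2
    · apply mul_left_cancel₀ hδ
      simp only [Fin.mk_one, Pi.zero_apply]
      linear_combination l i 0 * h2 - m i 0 * h1
  · intro i
    refine ⟨⟨![m i 1, - m i 0], fun h0 => (hm i).1 ?_⟩, ?_⟩
    · have h1 := congrFun h0 0
      have h2 := congrFun h0 1
      ext k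
      fin_cases k
      · simpa using h2
      · simpa using h1
    · rw [norm_eq_zero]
      simp [dotProduct, Fin.sum_univ_two]
      ring
  · intro i w
    have := ((hl i).map_pow M).dotProduct_mulVec w.1
    change ‖l i ⬝ᵥ (ρ (z i ^ M) *ᵥ w.1)‖ = _
    rw [this, norm_mul, norm_pow]
  · intro i w
    have := ((hm i).map_pow M).dotProduct_mulVec w.1
    change _ * ‖m i ⬝ᵥ (ρ (z i ^ M) *ᵥ w.1)‖ = _
    rw [this, norm_mul, norm_pow, norm_inv, ← mul_assoc, ← mul_pow,
      mul_inv_cancel₀ (norm_ne_zero_iff.2 (hν0 i)), one_pow, one_mul]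

/-- Two elements are commensurable if they have a common nonzero power. -/
def IsCommensurable (g h : G) : Prop := ∃ a b : ℤ, a ≠ 0 ∧ b ≠ 0 ∧ g ^ a = h ^ b

theorem IsCommensurable.symm {g h : G} : IsCommensurable g h → IsCommensurable h g :=
  fun ⟨a, b, ha, hb, hab⟩ => ⟨b, a, hb, ha, hab.symm⟩

theorem IsCommensurable.trans {g h k : G} :
    IsCommensurable g h → IsCommensurable h k → IsCommensurable g k := by
  rintro ⟨a, b, ha, hb, hab⟩ ⟨c, e, hc, he, hce⟩
  refine ⟨a * c, e * b, mul_ne_zero ha hc, mul_ne_zero he hb, ?_⟩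
  rw [_root_.zpow_mul, hab, _root_.zpow_mul, ← hce, ← _root_.zpow_mul, ← _root_.zpow_mul, mul_comm]

theorem IsCommensurable.exists_pow_eq_zpow {g h : G} (hgh : IsCommensurable g h) :
    ∃ a : ℕ, 0 < a ∧ ∃ b : ℤ, b ≠ 0 ∧ g ^ a = h ^ b := by
  obtain ⟨a, b, ha, hb, hab⟩ := hgh
  refine ⟨a.natAbs, Int.natAbs_pos.2 ha, ?_⟩
  rcases Int.natAbs_eq a with h | h
  · exact ⟨b, hb, by rw [← _root_.zpow_natCast, ← h, hab]⟩
  · refine ⟨-b, neg_ne_zero.2 hb, ?_⟩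
    rw [_root_.zpow_neg, ← hab, ← _root_.zpow_neg, ← _root_.zpow_natCast]
    congr 1
    omega

/-- Commensurability as a setoid on an indexing type. -/
def commensurableSetoid {I : Type} (x : I → G) : Setoid I where
  r i j := IsCommensurable (x i) (x j)
  iseqv := ⟨fun _ => ⟨1, 1, one_ne_zero, one_ne_zero, rfl⟩, .symm, .trans⟩

theorem closure_range_pow_eq {J ι : Type} {P : J → Prop} (x : J → G) (q : {j // P j} → ι)
    (y z : ι → G) (A m : ℕ) (c : {j // P j} → ℤ) (e : ι → ℤ)
    (hx0 : ∀ j, ¬ P j → x j ^ (A * m) = 1)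
    (hx : ∀ i : {j // P j}, x i ^ A = y (q i) ^ c i)
    (he : ∀ k, AddSubgroup.closure (c '' {i | q i = k}) = AddSubgroup.closure {e k})
    (hz : ∀ k, z k = y k ^ e k) :
    Subgroup.closure (Set.range fun j => x j ^ (A * m)) =
      Subgroup.closure (Set.range fun k => z k ^ m) := by
  have hx' : ∀ i : {j // P j}, x i ^ (A * m) = y (q i) ^ (c i * m) := fun i => by
    rw [pow_mul, hx i, _root_.zpow_mul, _root_.zpow_natCast]
  apply le_antisymm
  · rw [Subgroup.closure_le]
    rintro _ ⟨j, rfl⟩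
    simp only [SetLike.mem_coe]
    by_cases h : P j
    · obtain ⟨i, rfl⟩ : ∃ i : {j // P j}, i.1 = j := ⟨⟨j, h⟩, rfl⟩
      have : c i ∈ AddSubgroup.closure {e (q i)} :=
        he (q i) ▸ AddSubgroup.subset_closure ⟨i, rfl, rfl⟩
      obtain ⟨t, ht⟩ := AddSubgroup.mem_closure_singleton.1 this
      rw [hx' i, ← ht, smul_eq_mul, show t * e (q i) * m = e (q i) * m * t by ring,
        _root_.zpow_mul, _root_.zpow_mul, ← hz, _root_.zpow_natCast]
      exact zpow_mem (Subgroup.subset_closure (Set.mem_range_self (q i))) t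
    · rw [hx0 j h]; exact one_mem _
  · rw [Subgroup.closure_le]
    rintro _ ⟨k, rfl⟩
    simp only [SetLike.mem_coe]
    have key : ∀ t ∈ AddSubgroup.closure (c '' {i | q i = k}),
        y k ^ (t * m) ∈ Subgroup.closure (Set.range fun j => x j ^ (A * m)) := by
      intro t ht
      induction ht using AddSubgroup.closure_induction with
      | mem t ht =>
        obtain ⟨i, rfl, rfl⟩ := ht
        rw [← hx' i]
        exact Subgroup.subset_closure ⟨i, rfl⟩
      | zero => simp
      | add t t' _ _ h h' => rw [add_mul, _root_.zpow_add]; exact mul_mem h h'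
      | neg t _ h => rw [neg_mul, _root_.zpow_neg]; exact inv_mem h
    have := key (e k) (he k ▸ AddSubgroup.subset_closure rfl)
    rwa [_root_.zpow_mul, ← hz, _root_.zpow_natCast] at this

theorem exists_closure_range_pow_mulEquiv_freeGroup (hdet : ∀ g, (ρ g).det = 1)
    (hunit : ∀ g ν l, IsEigencovector (ρ g) ν l → ‖ν‖ = 1 → g ^ 4 = 1)
    (hcomm : ∀ g h μ ν l, IsEigencovector (ρ g) μ l → IsEigencovector (ρ h) ν l → Commute g h)
    (hfin : ∀ B : ℝ, {t : ℂ | (∃ g, (ρ g).trace = t) ∧ ‖t‖ ≤ B}.Finite)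
    (n : ℕ) (x : Fin n → G) :
    ∃ m : ℕ, 0 < m ∧ ∃ k ≤ n,
      Nonempty (Subgroup.closure (Set.range fun i => x i ^ m) ≃* FreeGroup (Fin k)) := by
  classical
  let I := {i : Fin n // x i ^ 4 ≠ 1}
  let S : Setoid I := commensurableSetoid fun i : I => x i
  let y : Quotient S → G := fun k => x k.out
  have hy : ∀ k, y k ^ 4 ≠ 1 := fun k => k.out.2
  have hpow : ∀ i : I, ∃ a : ℕ, 0 < a ∧ ∃ b : ℤ, b ≠ 0 ∧ x i ^ a = y ⟦i⟧ ^ b := fun i =>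
    IsCommensurable.exists_pow_eq_zpow (IsCommensurable.symm (Quotient.mk_out i))
  choose a ha b hb hab using hpow
  let A : ℕ := ∏ i, a i
  have hA : 0 < A := Finset.prod_pos fun i _ => ha i
  have hc : ∀ i : I, ∃ c : ℤ, c ≠ 0 ∧ x i ^ A = y ⟦i⟧ ^ c := fun i => by
    obtain ⟨t, ht⟩ := Finset.dvd_prod_of_mem a (Finset.mem_univ i)
    refine ⟨b i * t, mul_ne_zero (hb i) ?_, ?_⟩
    · rintro h
      have : t = 0 := by exact_mod_cast h
      rw [this, mul_zero] at ht
      exact hA.ne' ht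
    · change x i ^ (∏ i, a i) = _
      rw [ht, pow_mul, hab, _root_.zpow_mul, _root_.zpow_natCast]
  choose c hc0 hc using hc
  choose e he using fun k : Quotient S => Int.subgroup_cyclic
    (AddSubgroup.closure (c '' {i | (⟦i⟧ : Quotient S) = k}))
  have he0 : ∀ k, e k ≠ 0 := fun k h => by
    have : c k.out ∈ AddSubgroup.closure {e k} :=
      he k ▸ AddSubgroup.subset_closure ⟨k.out, k.out_eq, rfl⟩
    rw [h, AddSubgroup.mem_closure_singleton] at this
    obtain ⟨t, ht⟩ := this
    exact hc0 _ (by rw [← ht, smul_zero])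
  let z : Quotient S → G := fun k => y k ^ e k
  have hz : ∀ k, z k ^ 4 ≠ 1 := fun k h => by
    rw [← _root_.zpow_natCast, ← _root_.zpow_mul] at h
    have := zpow_eq_zero_of_zpow_eq_one hdet hunit (hy k) h
    rcases mul_eq_zero.1 this with h | h
    · exact he0 k h
    · simp at h
  have hyz : ∀ k, IsCommensurable (y k) (z k) := fun k =>
    ⟨e k, 1, he0 k, one_ne_zero, by simp [z]⟩
  have hindep : ∀ k k', k ≠ k' → ∀ μ ν l, IsEigencovector (ρ (z k)) μ l →
      ¬ IsEigencovector (ρ (z k')) ν l := by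
    intro k k' hkk μ ν l h h'
    apply hkk
    rw [← k.out_eq, ← k'.out_eq]
    apply Quotient.sound
    exact (hyz k).trans (IsCommensurable.trans
      (exists_zpow_eq_zpow hdet hunit hcomm hfin (hz k) (hz k') h h') (hyz k').symm)
  obtain ⟨N, hN⟩ := eventually_atTop.1 (eventually_injective_lift_pow hdet hunit z hz hindep)
  have hinj := hN (4 * (N + 1)) (by omega)
  refine ⟨A * (4 * (N + 1)), by positivity, Fintype.card (Quotient S), ?_, ?_⟩
  · exact (Fintype.card_quotient_le S).trans
      ((Fintype.card_subtype_le _).trans (Fintype.card_fin n).le)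
  · have hcl := closure_range_pow_eq x (fun i => (⟦i⟧ : Quotient S)) y z A (4 * (N + 1)) c e
      (fun j hj => by
        rw [show A * (4 * (N + 1)) = 4 * (A * (N + 1)) by ring, pow_mul, not_not.1 hj, one_pow])
      hc he (fun _ => rfl)
    rw [hcl, ← FreeGroup.range_lift_eq_closure]
    exact ⟨(MonoidHom.ofInjective hinj).symm.trans
      (FreeGroup.freeGroupCongr (Fintype.equivFin (Quotient S)))⟩

theorem closure_range_mulEquiv_of_injective {H I : Type} [Group H] (f : G →* H)
    (hf : Function.Injective f) (x : I → G) : Nonempty (Subgroup.closure (Set.range x) ≃*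
      Subgroup.closure (Set.range fun i => f (x i))) := by
  have : Subgroup.closure (Set.range fun i => f (x i)) =
      (Subgroup.closure (Set.range x)).map f := by
    rw [MonoidHom.map_closure, ← Set.range_comp]
    rfl
  rw [this]
  exact ⟨Subgroup.equivMapOfInjective _ f hf⟩

end Representation

end

section QuaternionRepresentation

open QuaternionGroup

open scoped Quaternion

theorem sum_quaternionGroup_two {A : Type*} [AddCommMonoid A] (f : QuaternionGroup 2 → A) :
    ∑ g, f g = f (a 0) + f (a 1) + f (a 2) + f (a 3) +
      (f (xa 0) + f (xa 1) + f (xa 2) + f (xa 3)) := by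
  have : (Finset.univ : Finset (QuaternionGroup 2)) =
      {a 0, a 1, a 2, a 3, xa 0, xa 1, xa 2, xa 3} := by decide
  rw [this]
  repeat rw [Finset.sum_insert (by decide)]
  rw [Finset.sum_singleton]
  simp only [add_assoc]

/-- The coordinates of an element of `QuaternionGroup 2` with respect to `1, i, j, k`. -/
def quaternionGroupCoord : QuaternionGroup 2 → Fin 4 → ℤ
  | a i => (![![1, 0, 0, 0], ![0, 1, 0, 0], ![-1, 0, 0, 0], ![0, -1, 0, 0]] : Fin 4 → Fin 4 → ℤ) i
  | xa i => (![![0, 0, 1, 0], ![0, 0, 0, -1], ![0, 0, -1, 0], ![0, 0, 0, 1]] : Fin 4 → Fin 4 → ℤ) i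

set_option maxRecDepth 10000 in
theorem quaternionGroupCoord_mul : ∀ g h : QuaternionGroup 2,
    let x := quaternionGroupCoord g
    let y := quaternionGroupCoord h
    quaternionGroupCoord (g * h) =
      ![x 0 * y 0 - x 1 * y 1 - x 2 * y 2 - x 3 * y 3,
        x 0 * y 1 + x 1 * y 0 + x 2 * y 3 - x 3 * y 2,
        x 0 * y 2 - x 1 * y 3 + x 2 * y 0 + x 3 * y 1,
        x 0 * y 3 + x 1 * y 2 - x 2 * y 1 + x 3 * y 0] := by
  decide

/-- The quaternion with given integral coordinates. -/
def quaternionOfCoord (S : Type) [CommRing S] (v : Fin 4 → ℤ) : Quaternion S :=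
  ⟨v 0, v 1, v 2, v 3⟩

section

variable (S : Type) [CommRing S] (v : Fin 4 → ℤ)

theorem re_quaternionOfCoord : (quaternionOfCoord S v).re = v 0 := rfl

theorem imI_quaternionOfCoord : (quaternionOfCoord S v).imI = v 1 := rfl

theorem imJ_quaternionOfCoord : (quaternionOfCoord S v).imJ = v 2 := rfl

theorem imK_quaternionOfCoord : (quaternionOfCoord S v).imK = v 3 := rfl

end

/-- The embedding of `QuaternionGroup 2` in the quaternions. -/
def quaternionGroupToQuaternion (S : Type) [CommRing S] : QuaternionGroup 2 →* Quaternion S where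
  toFun g := quaternionOfCoord S (quaternionGroupCoord g)
  map_one' := by
    have : quaternionGroupCoord 1 = ![1, 0, 0, 0] := by decide
    apply Quaternion.ext <;> simp [this, re_quaternionOfCoord, imI_quaternionOfCoord,
      imJ_quaternionOfCoord, imK_quaternionOfCoord]
  map_mul' g h := by
    have := quaternionGroupCoord_mul g h
    apply Quaternion.ext <;>
      simp [this, Quaternion.re_mul, Quaternion.imI_mul, Quaternion.imJ_mul, Quaternion.imK_mul,
        re_quaternionOfCoord, imI_quaternionOfCoord, imJ_quaternionOfCoord, imK_quaternionOfCoord]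

theorem quaternionGroupToQuaternion_apply (S : Type) [CommRing S] (g : QuaternionGroup 2) :
    quaternionGroupToQuaternion S g = quaternionOfCoord S (quaternionGroupCoord g) := rfl

theorem quaternionGroupCoord_values :
    quaternionGroupCoord (a 0) = ![1, 0, 0, 0] ∧ quaternionGroupCoord (a 1) = ![0, 1, 0, 0] ∧
    quaternionGroupCoord (a 2) = ![-1, 0, 0, 0] ∧ quaternionGroupCoord (a 3) = ![0, -1, 0, 0] ∧
    quaternionGroupCoord (xa 0) = ![0, 0, 1, 0] ∧ quaternionGroupCoord (xa 1) = ![0, 0, 0, -1] ∧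
    quaternionGroupCoord (xa 2) = ![0, 0, -1, 0] ∧ quaternionGroupCoord (xa 3) = ![0, 0, 0, 1] := by
  decide

/-- The integral linear characters of `QuaternionGroup 2`. -/
def quaternionGroupCharacter (e f : Bool) : QuaternionGroup 2 →* ℤ where
  toFun
    | a i => if e then (![1, -1, 1, -1] : Fin 4 → ℤ) i else 1
    | xa i => (if f then -1 else 1) * if e then (![1, -1, 1, -1] : Fin 4 → ℤ) i else 1
  map_one' := by cases e <;> rfl
  map_mul' := by
    revert e f
    decide

theorem quaternionGroupCharacter_values : ∀ e f,
    quaternionGroupCharacter e f (a 0) = 1 ∧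
    quaternionGroupCharacter e f (a 1) = (if e then -1 else 1) ∧
    quaternionGroupCharacter e f (a 2) = 1 ∧
    quaternionGroupCharacter e f (a 3) = (if e then -1 else 1) ∧
    quaternionGroupCharacter e f (xa 0) = (if f then -1 else 1) ∧
    quaternionGroupCharacter e f (xa 1) = (if f then -1 else 1) * (if e then -1 else 1) ∧
    quaternionGroupCharacter e f (xa 2) = (if f then -1 else 1) ∧
    quaternionGroupCharacter e f (xa 3) = (if f then -1 else 1) * (if e then -1 else 1) := by
  decide

variable (S : Type) [CommRing S]

/-- The homomorphism from the group ring of `QuaternionGroup 2` to the quaternions. -/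
noncomputable def quaternionProjection :
    MonoidAlgebra S (QuaternionGroup 2) →ₐ[S] Quaternion S :=
  MonoidAlgebra.lift S _ _ (quaternionGroupToQuaternion S)

/-- The homomorphism from the group ring of `QuaternionGroup 2` given by a linear character. -/
noncomputable def characterProjection (e f : Bool) :
    MonoidAlgebra S (QuaternionGroup 2) →ₐ[S] S :=
  MonoidAlgebra.lift S _ _ ((Int.castRingHom S : ℤ →* S).comp (quaternionGroupCharacter e f))

variable {S}

theorem quaternionProjection_apply (z : MonoidAlgebra S (QuaternionGroup 2)) :
    quaternionProjection S z = (⟨z.coeff (a 0) - z.coeff (a 2), z.coeff (a 1) - z.coeff (a 3),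
      z.coeff (xa 0) - z.coeff (xa 2), z.coeff (xa 3) - z.coeff (xa 1)⟩ : Quaternion S) := by
  rw [quaternionProjection, MonoidAlgebra.lift_apply, Finsupp.sum_fintype _ _ (by simp),
    sum_quaternionGroup_two]
  obtain ⟨h0, h1, h2, h3, h4, h5, h6, h7⟩ := quaternionGroupCoord_values
  simp only [quaternionGroupToQuaternion_apply, h0, h1, h2, h3, h4, h5, h6, h7]
  apply Quaternion.ext <;> simp [re_quaternionOfCoord, imI_quaternionOfCoord,
    imJ_quaternionOfCoord, imK_quaternionOfCoord] <;> ring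

theorem characterProjection_apply (e f : Bool) (z : MonoidAlgebra S (QuaternionGroup 2)) :
    characterProjection S e f z = z.coeff (a 0) + z.coeff (a 2) +
      (if e then -1 else 1) * (z.coeff (a 1) + z.coeff (a 3)) +
      (if f then -1 else 1) * (z.coeff (xa 0) + z.coeff (xa 2) +
      (if e then -1 else 1) * (z.coeff (xa 1) + z.coeff (xa 3))) := by
  rw [characterProjection, MonoidAlgebra.lift_apply, Finsupp.sum_fintype _ _ (by simp),
    sum_quaternionGroup_two]
  obtain ⟨h0, h1, h2, h3, h4, h5, h6, h7⟩ := quaternionGroupCharacter_values e f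
  simp only [MonoidHom.comp_apply, h0, h1, h2, h3, h4, h5, h6, h7]
  cases e <;> cases f <;> simp <;> ring

theorem eq_of_projections_eq [IsDomain S] [CharZero S] {z w : MonoidAlgebra S (QuaternionGroup 2)}
    (h : quaternionProjection S z = quaternionProjection S w)
    (h' : ∀ e f, characterProjection S e f z = characterProjection S e f w) : z = w := by
  have h1 := h' false false
  have h2 := h' false true
  have h3 := h' true false
  have h4 := h' true true
  have h5 := congr_arg QuaternionAlgebra.re h
  have h6 := congr_arg QuaternionAlgebra.imI h
  have h7 := congr_arg QuaternionAlgebra.imJ h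
  have h8 := congr_arg QuaternionAlgebra.imK h
  simp only [quaternionProjection_apply] at h5 h6 h7 h8
  simp only [characterProjection_apply, if_true, Bool.false_eq_true, if_false] at h1 h2 h3 h4
  have h0 : (8 : S) ≠ 0 := by norm_num
  apply MonoidAlgebra.ext
  ext g
  apply mul_left_cancel₀ h0
  rcases g with i | i <;> change Fin 4 at i <;> fin_cases i
  · change 8 * z.coeff (a 0) = 8 * w.coeff (a 0)
    linear_combination h1 + h2 + h3 + h4 + 4 * h5
  · change 8 * z.coeff (a 1) = 8 * w.coeff (a 1)
    linear_combination h1 + h2 - h3 - h4 + 4 * h6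
  · change 8 * z.coeff (a 2) = 8 * w.coeff (a 2)
    linear_combination h1 + h2 + h3 + h4 - 4 * h5
  · change 8 * z.coeff (a 3) = 8 * w.coeff (a 3)
    linear_combination h1 + h2 - h3 - h4 - 4 * h6
  · change 8 * z.coeff (xa 0) = 8 * w.coeff (xa 0)
    linear_combination h1 - h2 + h3 - h4 + 4 * h7
  · change 8 * z.coeff (xa 1) = 8 * w.coeff (xa 1)
    linear_combination h1 - h2 - h3 + h4 - 4 * h8
  · change 8 * z.coeff (xa 2) = 8 * w.coeff (xa 2)
    linear_combination h1 - h2 + h3 - h4 - 4 * h7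
  · change 8 * z.coeff (xa 3) = 8 * w.coeff (xa 3)
    linear_combination h1 - h2 - h3 + h4 + 4 * h8

/-- The splitting of the quaternions by a ring homomorphism to `ℂ`. -/
noncomputable def quaternionToMatrix (φ : S →+* ℂ) :
    Quaternion S →* Matrix (Fin 2) (Fin 2) ℂ where
  toFun q := !![φ q.re + φ q.imI * Complex.I, φ q.imJ + φ q.imK * Complex.I;
    -φ q.imJ + φ q.imK * Complex.I, φ q.re - φ q.imI * Complex.I]
  map_one' := by simp [Matrix.one_fin_two]
  map_mul' p q := by
    rw [Matrix.mul_fin_two]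
    simp only [Quaternion.re_mul, Quaternion.imI_mul, Quaternion.imJ_mul, Quaternion.imK_mul,
      map_add, map_sub, map_mul]
    refine congrArg Matrix.of (congrArg₂ (![·, ·]) (congrArg₂ (![·, ·]) ?_ ?_)
      (congrArg₂ (![·, ·]) ?_ ?_))
    · linear_combination -(φ p.imI * φ q.imI + φ p.imK * φ q.imK) * Complex.I_sq
    · linear_combination -(φ p.imI * φ q.imK - φ p.imK * φ q.imI) * Complex.I_sq
    · linear_combination (φ p.imI * φ q.imK - φ p.imK * φ q.imI) * Complex.I_sq
    · linear_combination -(φ p.imI * φ q.imI + φ p.imK * φ q.imK) * Complex.I_sq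

theorem det_quaternionToMatrix (φ : S →+* ℂ) (q : Quaternion S) :
    (quaternionToMatrix φ q).det = φ (Quaternion.normSq q) := by
  simp only [quaternionToMatrix, MonoidHom.coe_mk, OneHom.coe_mk, Matrix.det_fin_two_of,
    Quaternion.normSq_def', map_add, map_pow]
  linear_combination (-φ q.imI ^ 2 - φ q.imK ^ 2) * Complex.I_sq

theorem trace_quaternionToMatrix (φ : S →+* ℂ) (q : Quaternion S) :
    (quaternionToMatrix φ q).trace = 2 * φ q.re := by
  simp only [quaternionToMatrix, MonoidHom.coe_mk, OneHom.coe_mk, Matrix.trace_fin_two_of]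
  ring

theorem quaternionToMatrix_sub (φ : S →+* ℂ) (p q : Quaternion S) :
    quaternionToMatrix φ (p - q) = quaternionToMatrix φ p - quaternionToMatrix φ q := by
  simp only [quaternionToMatrix, MonoidHom.coe_mk, OneHom.coe_mk, Quaternion.re_sub,
    Quaternion.imI_sub, Quaternion.imJ_sub, Quaternion.imK_sub, map_sub]
  ext i j
  fin_cases i <;> fin_cases j <;> simp <;> ring

variable (S) in
/-- The linear characters and the norm of the quaternion component of the group ring. -/
noncomputable def groupRingComponents :
    MonoidAlgebra S (QuaternionGroup 2) →* (Option (Bool × Bool) → S) :=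
  MonoidHom.pi fun
    | none => (Quaternion.normSq : Quaternion S →*₀ S).toMonoidHom.comp
        (quaternionProjection S : MonoidAlgebra S (QuaternionGroup 2) →* Quaternion S)
    | some (e, f) => (characterProjection S e f : MonoidAlgebra S (QuaternionGroup 2) →* S)

variable (S) in
/-- The units of the group ring with trivial linear characters and norm one. -/
noncomputable def specialUnits : Subgroup (MonoidAlgebra S (QuaternionGroup 2))ˣ :=
  ((groupRingComponents S).comp (Units.coeHom _)).ker

theorem normSq_quaternionProjection (u : specialUnits S) :
    Quaternion.normSq (quaternionProjection S (u : (MonoidAlgebra S (QuaternionGroup 2))ˣ)) = 1 :=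
  congrFun (MonoidHom.mem_ker.1 u.2) none

theorem characterProjection_eq_one (u : specialUnits S) (e f : Bool) :
    characterProjection S e f (u : (MonoidAlgebra S (QuaternionGroup 2))ˣ) = 1 :=
  congrFun (MonoidHom.mem_ker.1 u.2) (some (e, f))

theorem specialUnits_ext [IsDomain S] [CharZero S] {u v : specialUnits S}
    (h : quaternionProjection S (u : (MonoidAlgebra S (QuaternionGroup 2))ˣ) =
      quaternionProjection S (v : (MonoidAlgebra S (QuaternionGroup 2))ˣ)) : u = v := by
  ext1
  ext1
  exact eq_of_projections_eq h fun e f => by rw [characterProjection_eq_one,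
    characterProjection_eq_one]

/-- The two-dimensional complex representation of the special units. -/
noncomputable def specialUnitsRep (φ : S →+* ℂ) : specialUnits S →* Matrix (Fin 2) (Fin 2) ℂ :=
  (quaternionToMatrix φ).comp
    ((quaternionProjection S : MonoidAlgebra S (QuaternionGroup 2) →* Quaternion S).comp
      ((Units.coeHom _).comp (specialUnits S).subtype))

theorem specialUnitsRep_apply (φ : S →+* ℂ) (u : specialUnits S) :
    specialUnitsRep φ u = quaternionToMatrix φ
      (quaternionProjection S (u : (MonoidAlgebra S (QuaternionGroup 2))ˣ)) := rfl

theorem det_specialUnitsRep (φ : S →+* ℂ) (u : specialUnits S) : (specialUnitsRep φ u).det = 1 := by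
  rw [specialUnitsRep_apply, det_quaternionToMatrix, normSq_quaternionProjection, map_one]

theorem eq_zero_of_normSq_eq_zero
    (haniso : ∀ w x y z : S, w ^ 2 + x ^ 2 + y ^ 2 + z ^ 2 = 0 → w = 0 ∧ x = 0 ∧ y = 0 ∧ z = 0)
    {q : Quaternion S} (hq : Quaternion.normSq q = 0) : q = 0 := by
  rw [Quaternion.normSq_def'] at hq
  obtain ⟨h0, h1, h2, h3⟩ := haniso _ _ _ _ hq
  exact Quaternion.ext _ _ h0 h1 h2 h3

theorem quaternion_pow_four_eq_one
    (haniso : ∀ w x y z : S, w ^ 2 + x ^ 2 + y ^ 2 + z ^ 2 = 0 → w = 0 ∧ x = 0 ∧ y = 0 ∧ z = 0)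
    {q : Quaternion S} (hq : Quaternion.normSq q = 1) (hre : q.re = 0 ∨ q.re = 1 ∨ q.re = -1) :
    q ^ 4 = 1 := by
  rw [Quaternion.normSq_def'] at hq
  rcases hre with h | h
  · have : q ^ 2 = -1 := by
      rw [sq]
      apply Quaternion.ext <;>
        simp only [Quaternion.re_mul, Quaternion.imI_mul, Quaternion.imJ_mul, Quaternion.imK_mul,
          Quaternion.re_neg, Quaternion.imI_neg, Quaternion.imJ_neg, Quaternion.imK_neg,
          Quaternion.re_one, Quaternion.imI_one, Quaternion.imJ_one, Quaternion.imK_one]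
      · linear_combination -hq + 2 * q.re * h
      · linear_combination 2 * q.imI * h
      · linear_combination 2 * q.imJ * h
      · linear_combination 2 * q.imK * h
    rw [show 4 = 2 * 2 from rfl, pow_mul, this, neg_one_sq]
  · have hsq : q.re ^ 2 = 1 := by rcases h with h | h <;> rw [h] <;> ring
    obtain ⟨-, h1, h2, h3⟩ := haniso 0 q.imI q.imJ q.imK (by linear_combination hq - hsq)
    rcases h with h | h
    · rw [show q = 1 from Quaternion.ext _ _ h h1 h2 h3, one_pow]
    · rw [show q = -1 from Quaternion.ext _ _ h (by simpa using h1) (by simpa using h2)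
        (by simpa using h3), Even.neg_one_pow (by decide)]

theorem specialUnits_pow_four_eq_one [IsDomain S] [CharZero S]
    (haniso : ∀ w x y z : S, w ^ 2 + x ^ 2 + y ^ 2 + z ^ 2 = 0 → w = 0 ∧ x = 0 ∧ y = 0 ∧ z = 0)
    {φ : S →+* ℂ}
    (hreal : ∀ (x : S) (r : ℝ), |r| ≤ 1 → φ x = r → x = 0 ∨ x = 1 ∨ x = -1)
    {u : specialUnits S} {ν : ℂ} {l : Fin 2 → ℂ} (h : IsEigencovector (specialUnitsRep φ u) ν l)
    (hν : ‖ν‖ = 1) : u ^ 4 = 1 := by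
  apply specialUnits_ext
  simp only [SubmonoidClass.coe_pow, Units.val_pow_eq_pow_val, map_pow, OneMemClass.coe_one,
    Units.val_one, map_one]
  refine quaternion_pow_four_eq_one haniso (normSq_quaternionProjection u)
    (hreal _ ν.re (hν ▸ Complex.abs_re_le_norm ν) ?_)
  have htr := h.trace_eq (det_specialUnitsRep φ u)
  rw [specialUnitsRep_apply, trace_quaternionToMatrix, Complex.inv_eq_conj hν,
    Complex.add_conj] at htr
  exact mul_left_cancel₀ two_ne_zero (by exact_mod_cast htr)

theorem specialUnits_commute [IsDomain S] [CharZero S]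
    (haniso : ∀ w x y z : S, w ^ 2 + x ^ 2 + y ^ 2 + z ^ 2 = 0 → w = 0 ∧ x = 0 ∧ y = 0 ∧ z = 0)
    {φ : S →+* ℂ} (hφ : Function.Injective φ) {u v : specialUnits S} {μ ν : ℂ} {l : Fin 2 → ℂ}
    (hu : IsEigencovector (specialUnitsRep φ u) μ l)
    (hv : IsEigencovector (specialUnitsRep φ v) ν l) : Commute u v := by
  apply specialUnits_ext
  rw [← sub_eq_zero]
  apply eq_zero_of_normSq_eq_zero haniso
  apply hφ
  rw [← det_quaternionToMatrix, quaternionToMatrix_sub, ← specialUnitsRep_apply,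
    ← specialUnitsRep_apply, map_zero]
  refine Matrix.exists_vecMul_eq_zero_iff.1 ⟨l, hu.1, ?_⟩
  rw [Matrix.vecMul_sub, map_mul, map_mul, (hu.mul hv).2, (hv.mul hu).2, mul_comm, sub_self]

theorem exists_pow_mem_specialUnits (htors : ∀ x : Sˣ, ∃ n, 0 < n ∧ x ^ n = 1)
    (u : (MonoidAlgebra S (QuaternionGroup 2))ˣ) : ∃ n, 0 < n ∧ u ^ n ∈ specialUnits S := by
  choose n hn hun using fun p : Option (Bool × Bool) =>
    htors (Units.map ((Pi.evalMonoidHom _ p).comp (groupRingComponents S)) u)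
  refine ⟨∏ p, n p, Finset.prod_pos fun p _ => hn p, MonoidHom.mem_ker.2 (funext fun p => ?_)⟩
  obtain ⟨t, ht⟩ := Finset.dvd_prod_of_mem n (Finset.mem_univ p)
  have := congrArg Units.val (hun p)
  rw [ht, pow_mul, map_pow, Pi.pow_apply, map_pow, Pi.pow_apply]
  simp only [Units.val_pow_eq_pow_val, Units.coe_map, Units.val_one] at this
  exact (congrArg (· ^ t) this).trans (one_pow t)

end QuaternionRepresentation

/-- Let `d > 0` be square-free with `d ≡ 7 (mod 8)`, `K = ℚ(√−d)`,
`R = 𝓞 K`, and let `K₈` be the quaternion group of order 8. If `u₁, …, uₙ` are units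
of the group ring `R K₈`, then there is a positive integer `m` such that the subgroup
`⟨u₁ᵐ, …, uₙᵐ⟩` of the unit group of `R K₈` is a free group of rank at most `n`, i.e.
it is isomorphic to a free group on `k` generators for some `k ≤ n`. -/
theorem group_ring_units_powers_free
    (d : ℤ) (hd : 0 < d) (hsf : Squarefree d) (hd7 : d % 8 = 7)
    (K : Type) [Field K] [NumberField K]
    (rd : 𝓞 K) (hrd : rd ^ 2 = -(d : 𝓞 K))
    (hgen : Algebra.adjoin ℚ {(rd : K)} = ⊤)
    (n : ℕ) (u : Fin n → (MonoidAlgebra (𝓞 K) (QuaternionGroup 2))ˣ) :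
    ∃ m : ℕ, 0 < m ∧ ∃ k : ℕ, k ≤ n ∧
      Nonempty
        ((Subgroup.closure (Set.range fun i : Fin n => u i ^ m)) ≃* FreeGroup (Fin k)) := by
  have φ : K →+* ℂ := Classical.arbitrary _
  let ψ : 𝓞 K →+* ℂ := φ.comp (algebraMap (𝓞 K) K)
  have hψ : Function.Injective ψ :=
    φ.injective.comp (FaithfulSMul.algebraMap_injective (𝓞 K) K)
  have haniso := eq_zero_of_sum_four_sq hd7 hrd hgen
  choose N hN huN using fun i =>
    exists_pow_mem_specialUnits (exists_pow_eq_one_of_isUnit hd hrd hgen) (u i)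
  have hmem : ∀ i, u i ^ (∏ j, N j) ∈ specialUnits (𝓞 K) := fun i => by
    obtain ⟨t, ht⟩ := Finset.dvd_prod_of_mem N (Finset.mem_univ i)
    rw [ht, pow_mul]
    exact pow_mem (huN i) t
  obtain ⟨m, hm, k, hk, ⟨e⟩⟩ := exists_closure_range_pow_mulEquiv_freeGroup
    (det_specialUnitsRep ψ)
    (fun g ν l => specialUnits_pow_four_eq_one haniso
      (eq_of_embedding_eq_ofReal hd hrd hgen φ))
    (fun g h μ ν l => specialUnits_commute haniso hψ)
    (fun B => by
      refine ((finite_norm_embedding_le hd hrd hgen φ B).image fun x => 2 * ψ x).subset ?_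
      rintro _ ⟨⟨g, rfl⟩, hg⟩
      rw [specialUnitsRep_apply, trace_quaternionToMatrix] at hg ⊢
      refine ⟨_, ?_, rfl⟩
      rw [norm_mul, Complex.norm_ofNat] at hg
      change ‖ψ _‖ ≤ B
      linarith [norm_nonneg (ψ (quaternionProjection (𝓞 K)
        (g : (MonoidAlgebra (𝓞 K) (QuaternionGroup 2))ˣ)).re)])
    n (fun i => ⟨u i ^ (∏ j, N j), hmem i⟩)
  refine ⟨(∏ j, N j) * m, Nat.mul_pos (Finset.prod_pos fun i _ => hN i) hm, k, hk, ?_⟩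
  obtain ⟨e'⟩ := closure_range_mulEquiv_of_injective (specialUnits (𝓞 K)).subtype
    (specialUnits (𝓞 K)).subtype_injective
    (fun i => (⟨u i ^ (∏ j, N j), hmem i⟩ : specialUnits (𝓞 K)) ^ m)
  simp only [Subgroup.subtype_apply, SubmonoidClass.coe_pow] at e'
  rw [show (fun i => u i ^ ((∏ j, N j) * m)) = fun i => (u i ^ (∏ j, N j)) ^ m from
    funext fun i => pow_mul (u i) _ _]
  exact ⟨e'.symm.trans e⟩
end

section
/- Let K = ℚ(√−7) and R = 𝓞_K = ℤ[(1+√−7)/2]. The element v = 6√−7 + 15i + 5j + k of ℍ(R) has norm η(v) = −1; consequently v is a unit of ℍ(R) of infinite multiplicative order. -/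
open Quaternion NumberField

/-- A quaternion of norm `-1` is a unit. -/
lemma isUnit_of_normSq_eq_neg_one {R : Type*} [CommRing R] {v : ℍ[R]}
    (hv : Quaternion.normSq v = -1) : IsUnit v := by
  refine isUnit_iff_exists.mpr ⟨-star v, ?_, ?_⟩
  · rw [mul_neg, Quaternion.self_mul_star, hv]; simp
  · rw [neg_mul, Quaternion.star_mul_self, hv]; simp

/-- If `r ^ 2 = -7`, the positive powers of `-(6r + 15i + 5j + k) ^ 2` have the form
`a - b r (15i + 5j + k)` with `a` and `b` positive integers. -/
lemma neg_sq_pow_succ_eq {R : Type*} [CommRing R] {r : R} (hr : r ^ 2 = -7) (n : ℕ) :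
    ∃ a b : ℤ, 0 < a ∧ 0 < b ∧
      (-(⟨6 * r, 15, 5, 1⟩ : ℍ[R]) ^ 2) ^ (n + 1) =
        ⟨a, -(15 * b * r), -(5 * b * r), -(b * r)⟩ := by
  have hsq : -(⟨6 * r, 15, 5, 1⟩ : ℍ[R]) ^ 2 =
      ⟨503, -(15 * 12 * r), -(5 * 12 * r), -(12 * r)⟩ := by
    rw [sq]
    ext <;> simp
    · linear_combination -36 * hr
    all_goals ring
  induction n with
  | zero => exact ⟨503, 12, by norm_num, by norm_num, by rw [zero_add, pow_one, hsq]; norm_num⟩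
  | succ n ih =>
    obtain ⟨a, b, ha, hb, h⟩ := ih
    refine ⟨503 * a + 12 * 1757 * b, 12 * a + 503 * b, by positivity, by positivity, ?_⟩
    rw [pow_succ, h, hsq]
    ext <;> simp
    · linear_combination (-3012 * b : R) * hr
    all_goals ring

/-- Let `K = ℚ(√−7)` and `R = 𝓞 K = ℤ[(1+√−7)/2]`. The element
`v = 6√−7 + 15i + 5j + k` of `ℍ(R)` has norm `η(v) = −1`; consequently `v` is a unit
of `ℍ(R)` of infinite multiplicative order. -/
theorem gauss_unit_sqrt_neg_seven
    (K : Type) [Field K] [NumberField K]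
    (rd : 𝓞 K) (hrd : rd ^ 2 = -(7 : 𝓞 K))
    (hgen : Algebra.adjoin ℚ {(rd : K)} = ⊤) :
    Quaternion.normSq (⟨6 * rd, 15, 5, 1⟩ : ℍ[𝓞 K]) = -1 ∧
      IsUnit (⟨6 * rd, 15, 5, 1⟩ : ℍ[𝓞 K]) ∧
      ∀ n : ℕ, 0 < n → (⟨6 * rd, 15, 5, 1⟩ : ℍ[𝓞 K]) ^ n ≠ 1 := by
  have hnorm : Quaternion.normSq (⟨6 * rd, 15, 5, 1⟩ : ℍ[𝓞 K]) = -1 := by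
    refine (Quaternion.normSq_def' _).trans ?_
    linear_combination 36 * hrd
  refine ⟨hnorm, isUnit_of_normSq_eq_neg_one hnorm, ?_⟩
  intro n hn hv
  obtain ⟨m, rfl⟩ := Nat.exists_eq_succ_of_ne_zero hn.ne'
  obtain ⟨a, b, -, hb, h⟩ := neg_sq_pow_succ_eq hrd m
  rw [neg_pow, ← pow_mul, mul_comm 2, pow_mul, hv, one_pow, mul_one] at h
  have hbr : (b : 𝓞 K) * rd = 0 := by
    rcases neg_one_pow_eq_or ℍ[𝓞 K] (m + 1) with h1 | h1 <;>
      simpa [eq_comm] using congrArg QuaternionAlgebra.imK (h1.symm.trans h)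
  rcases mul_eq_zero.mp hbr with h0 | h0
  · exact hb.ne' (Int.cast_eq_zero.mp h0)
  · rw [h0] at hrd
    norm_num at hrd
end
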